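/- arXiv:2303.08507 — 2 statements merged into one kernel-verified Lean document; each statement's English description precedes it below -/
import Mathlib

section
/- Every Neighbourhood Balancing Game (n, r, C) with continuous cost functions Cᵢ : Δᵣ(n) → ℝ≥0 admits an equilibrium, i.e., there exists x* ∈ Δᵣ(n) such that for all i, j ∈ [n], x*ᵢ > 0 implies Cᵢ(x*) ≤ Cⱼ(x*). -/
open Finset in
theorem nbg_room_parity {X I : Type*} [DecidableEq X] [Fintype I] [DecidableEq I]
    (c : X → I) (i0 : I) (S : Finset X) (hS : S.card = Fintype.card I) :
    Odd (S.filter (fun x => (S.erase x).image c = univ.erase i0)).card ↔ S.image c = univ := by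
  constructor
  · intro h
    by_contra hne
    obtain ⟨x, hx⟩ := card_pos.1 h.pos
    rw [mem_filter] at hx
    obtain ⟨hxS, hx⟩ := hx
    have hinj : Set.InjOn c (S.erase x : Finset X) := by
      apply card_image_iff.1
      rw [hx, card_erase_of_mem hxS, card_erase_of_mem (mem_univ _), hS, card_univ]
    have hmem : ∀ i, i ≠ i0 ↔ ∃ z, z ∈ S.erase x ∧ c z = i := by
      intro i
      have : i ∈ (S.erase x).image c ↔ i ∈ univ.erase i0 := by rw [hx]
      simp only [mem_image, mem_erase, mem_univ, and_true] at this
      rw [← this]; simp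
    have hcx : c x ≠ i0 := by
      intro hc
      apply hne
      ext i
      simp only [mem_image, mem_univ, iff_true]
      by_cases hi : i = i0
      · exact ⟨x, hxS, by rw [hc, hi]⟩
      · obtain ⟨z, hz, hzi⟩ := (hmem i).1 hi
        exact ⟨z, mem_of_mem_erase hz, hzi⟩
    obtain ⟨x', hx', hcx'⟩ := (hmem _).1 hcx
    have hx'2 := mem_erase.1 hx'
    have : S.filter (fun x => (S.erase x).image c = univ.erase i0) = {x, x'} := by
      ext z
      simp only [mem_filter, mem_insert, mem_singleton]
      constructor
      · rintro ⟨hzS, hz⟩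
        by_contra! hzn
        have hzD : z ∈ S.erase x := mem_erase.2 ⟨hzn.1, hzS⟩
        have h1 : c z ∈ (S.erase z).image c := by
          rw [hz]; simp only [mem_erase, mem_univ, and_true]
          exact (hmem _).2 ⟨z, hzD, rfl⟩
        obtain ⟨w, hw, hwz⟩ := mem_image.1 h1
        rw [mem_erase] at hw
        by_cases hwx : w = x
        · subst hwx
          exact hzn.2 (hinj hzD hx' (by rw [hcx', hwz]))
        · exact hw.1 (hinj (mem_coe.2 (mem_erase.2 ⟨hwx, hw.2⟩)) hzD hwz)
      · rintro (rfl | rfl)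
        · exact ⟨hxS, hx⟩
        · refine ⟨hx'2.2, ?_⟩
          rw [← hx]
          ext i
          simp only [mem_image, mem_erase]
          constructor
          · rintro ⟨w, ⟨hw1, hw2⟩, rfl⟩
            by_cases hwx : w = x
            · exact ⟨z, hx'2, by rw [hcx', hwx]⟩
            · exact ⟨w, ⟨hwx, hw2⟩, rfl⟩
          · rintro ⟨w, ⟨hw1, hw2⟩, rfl⟩
            by_cases hwx : w = z
            · exact ⟨x, ⟨fun h => hx'2.1 h.symm, hxS⟩, by rw [← hcx', hwx]⟩
            · exact ⟨w, ⟨hwx, hw2⟩, rfl⟩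
    rw [this, card_pair (fun h => hx'2.1 h.symm)] at h
    exact absurd h (by decide)
  · intro h
    have hinj : Set.InjOn c (S : Finset X) := by
      apply card_image_iff.1
      rw [h, hS, card_univ]
    obtain ⟨x, hx, hcx⟩ := mem_image.1 (h ▸ mem_univ i0)
    have : S.filter (fun x => (S.erase x).image c = univ.erase i0) = {x} := by
      ext z
      simp only [mem_filter, mem_singleton]
      constructor
      · rintro ⟨hzS, hz⟩
        by_contra hzx
        have : c x ∈ (S.erase z).image c :=
          mem_image_of_mem _ (mem_erase.2 ⟨fun h => hzx h.symm, hx⟩)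
        rw [hz, hcx] at this
        simp at this
      · rintro rfl
        refine ⟨hx, ?_⟩
        ext i
        simp only [mem_image, mem_erase, mem_univ, and_true]
        constructor
        · rintro ⟨w, ⟨hw1, hw2⟩, rfl⟩ h2
          exact hw1 (hinj hw2 hx (by rw [h2, hcx]))
        · intro hi
          obtain ⟨w, hw, hcw⟩ := mem_image.1 (h ▸ mem_univ i)
          exact ⟨w, ⟨fun h => hi (by rw [← hcw, h, hcx]), hw⟩, hcw⟩
    rw [this]; simp

open Finset in
theorem nbg_pseudo {X I : Type*} [Fintype X] [DecidableEq X] [Fintype I] [DecidableEq I]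
    (c : X → I) (i0 : I) (R : Finset (Finset X)) (hR : ∀ S ∈ R, S.card = Fintype.card I)
    (hD : ∀ D : Finset X, D.card + 1 = Fintype.card I →
      Even (univ.filter (fun x => x ∉ D ∧ insert x D ∈ R)).card) :
    Even (R.filter (fun S => S.image c = univ)).card := by
  by_contra hodd
  rw [Nat.not_even_iff_odd] at hodd
  have h1 : R.filter (fun S => S.image c = univ) = R.filter (fun S =>
      Odd (S.filter (fun x => (S.erase x).image c = univ.erase i0)).card) :=
    filter_congr fun S hS => (nbg_room_parity c i0 S (hR S hS)).symm
  rw [h1, ← odd_sum_iff_odd_card_odd] at hodd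
  have h2 : ∑ S ∈ R, (S.filter (fun x => (S.erase x).image c = univ.erase i0)).card =
      ∑ D ∈ univ.filter (fun D : Finset X => D.image c = univ.erase i0 ∧ D.card + 1 = Fintype.card I),
        (univ.filter (fun x => x ∉ D ∧ insert x D ∈ R)).card := by
    rw [← card_sigma, ← card_sigma]
    refine card_nbij' (fun p => ⟨p.1.erase p.2, p.2⟩) (fun p => ⟨insert p.2 p.1, p.2⟩) ?_ ?_ ?_ ?_
    · rintro ⟨S, x⟩ h
      simp only [coe_sigma, Set.mem_sigma_iff, mem_coe, mem_filter, mem_univ, true_and] at h ⊢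
      refine ⟨⟨h.2.2, ?_⟩, by simp, by rw [insert_erase h.2.1]; exact h.1⟩
      rw [← hR S h.1]; exact card_erase_add_one h.2.1
    · rintro ⟨D, x⟩ h
      simp only [coe_sigma, Set.mem_sigma_iff, mem_coe, mem_filter, mem_univ, true_and] at h ⊢
      refine ⟨h.2.2, by simp, ?_⟩
      rw [erase_insert h.2.1]; exact h.1.1
    · rintro ⟨S, x⟩ h
      simp only [coe_sigma, Set.mem_sigma_iff, mem_coe, mem_filter] at h
      simp [insert_erase h.2.1]
    · rintro ⟨D, x⟩ h
      simp only [coe_sigma, Set.mem_sigma_iff, mem_coe, mem_filter, mem_univ, true_and] at h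
      simp [erase_insert h.2.1]
  rw [h2] at hodd
  refine (Nat.not_even_iff_odd.2 hodd) (even_sum _ fun D h => hD D (mem_filter.1 h).2.2)
open Finset in
theorem nbg_door {T I : Type*} [Fintype T] [DecidableEq T] [Nonempty T] [Fintype I] [DecidableEq I]
    (g : I → T ⊕ I → ℤ)
    (h1 : ∀ i t, g i (Sum.inr i) < g i (Sum.inl t))
    (h2 : ∀ i k t, k ≠ i → g i (Sum.inl t) < g i (Sum.inr k))
    (hinj : ∀ i t t', g i (Sum.inl t) = g i (Sum.inl t') → t = t')
    (D : Finset (T ⊕ I)) (hD : D.card + 1 = Fintype.card I) :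
    Even (univ.filter (fun x => x ∉ D ∧ (insert x D = univ.image Sum.inr ∨
      ∀ t, ∃ i, ∀ z ∈ insert x D, g i (Sum.inl t) ≤ g i z))).card := by
  have h3 : ∀ i k, k ≠ i → g i (Sum.inr i) < g i (Sum.inr k) := fun i k hk =>
    (h1 i (Classical.arbitrary T)).trans (h2 i k _ hk)
  have h4 : ∀ i x, g i (Sum.inr i) ≤ g i x := by
    rintro i (t | k)
    · exact (h1 i t).le
    · by_cases hk : k = i
      · rw [hk]
      · exact (h3 i k hk).le
  have inj' : ∀ i x y, (∀ k, y = Sum.inr k → k = i) → g i x = g i y → x = y := by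
    rintro i (t | k) (t' | k') hy hxy
    · rw [hinj i t t' hxy]
    · obtain rfl := hy k' rfl
      exact absurd hxy (h1 k' t).ne'
    · by_cases hk : k = i
      · subst hk; exact absurd hxy (h1 _ _).ne
      · exact absurd hxy (h2 _ _ _ hk).ne'
    · obtain rfl := hy k' rfl
      by_cases hk : k = k'
      · rw [hk]
      · exact absurd hxy (h3 _ _ hk).ne'
  by_cases hsp : ∃ j, D = (univ.erase j).image Sum.inr
  · obtain ⟨j, rfl⟩ := hsp
    obtain ⟨t0, -, ht0⟩ := exists_max_image (univ : Finset T) (fun t => g j (Sum.inl t)) univ_nonempty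
    have : univ.filter (fun x : T ⊕ I => x ∉ (univ.erase j).image Sum.inr ∧
        (insert x ((univ.erase j).image (Sum.inr : I → T ⊕ I)) = univ.image Sum.inr ∨
        ∀ t, ∃ i, ∀ z ∈ insert x ((univ.erase j).image Sum.inr), g i (Sum.inl t) ≤ g i z))
        = {Sum.inr j, Sum.inl t0} := by
      ext x
      simp only [mem_filter, mem_univ, true_and, mem_insert, mem_singleton]
      constructor
      · rintro ⟨hx, hx2⟩
        rcases x with t | k
        · right
          rcases hx2 with hx2 | hx2
          · have : (Sum.inl t : T ⊕ I) ∈ univ.image (Sum.inr : I → T ⊕ I) := by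
              rw [← hx2]; simp
            simp at this
          · obtain ⟨i, hi⟩ := hx2 t0
            have hij : i = j := by
              by_contra hij
              exact absurd (hi (Sum.inr i) (Or.inr (by simp [hij]))) (not_le.2 (h1 _ _))
            subst hij
            rw [hinj i t t0 (le_antisymm (ht0 t (mem_univ _)) (hi _ (Or.inl rfl)))]
        · left
          by_contra hk
          apply hx
          simp only [mem_image, mem_erase, mem_univ, and_true]
          exact ⟨k, fun h => hk (by rw [h]), rfl⟩
      · rintro (rfl | rfl)
        · refine ⟨by simp, Or.inl ?_⟩
          rw [← image_insert, insert_erase (mem_univ _)]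
        · refine ⟨by simp, Or.inr fun t => ⟨j, ?_⟩⟩
          rintro z (rfl | hz)
          · exact ht0 t (mem_univ _)
          · simp only [mem_image, mem_erase, mem_univ, and_true] at hz
            obtain ⟨k, hk, rfl⟩ := hz
            exact (h2 _ _ _ hk).le
    rw [this, card_pair (by simp)]
    decide
  · have hns : ∀ x : T ⊕ I, x ∉ D → insert x D ≠ univ.image Sum.inr := by
      intro x hx h
      have hxm : x ∈ univ.image (Sum.inr : I → T ⊕ I) := by rw [← h]; simp
      obtain ⟨j, -, rfl⟩ := mem_image.1 hxm
      apply hsp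
      refine ⟨j, ?_⟩
      rw [← erase_insert hx, h, image_erase Sum.inr_injective]
    have hsub : ∀ i, ¬ ∀ x ∈ D, ∃ k, k ≠ i ∧ x = Sum.inr k := by
      intro i h
      apply hsp
      refine ⟨i, eq_of_subset_of_card_le ?_ ?_⟩
      · intro x hx
        obtain ⟨k, hk, rfl⟩ := h x hx
        simp [hk]
      · rw [card_image_of_injective _ Sum.inr_injective, card_erase_of_mem (mem_univ _), card_univ]
        omega
    have hmin : ∀ i, ∃ m ∈ D, ∀ x ∈ D, g i m ≤ g i x := by
      intro i
      apply exists_min_image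
      rw [nonempty_iff_ne_empty]
      rintro rfl
      exact hsub i (by simp)
    choose m hmD hm using hmin
    have hmk : ∀ i k, m i = Sum.inr k → k = i := by
      intro i k hk
      by_contra hki
      apply hsub i
      rintro (t | k') hx
      · have := hm i _ hx
        rw [hk] at this
        exact absurd this (not_le.2 (h2 _ _ _ hki))
      · refine ⟨k', ?_, rfl⟩
        intro hk2
        have := hm i _ hx
        rw [hk, hk2] at this
        exact absurd this (not_le.2 (h3 _ _ hki))
    have hmu : ∀ i x, g i x = g i (m i) → x = m i := fun i x h => inj' i x (m i) (hmk i) h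
    by_cases hemp : (univ.filter (fun x => x ∉ D ∧ (insert x D = univ.image Sum.inr ∨
      ∀ t, ∃ i, ∀ z ∈ insert x D, g i (Sum.inl t) ≤ g i z))) = ∅
    · rw [hemp]; simp
    obtain ⟨w, hw⟩ := nonempty_iff_ne_empty.2 hemp
    simp only [mem_filter, mem_univ, true_and] at hw
    have hDom : ∀ t, ∃ i, ∀ z ∈ D, g i (Sum.inl t) ≤ g i z := by
      intro t
      obtain ⟨i, hi⟩ := (hw.2.resolve_left (hns w hw.1)) t
      exact ⟨i, fun z hz => hi z (mem_insert_of_mem hz)⟩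
    have hminof : ∀ S : Finset (T ⊕ I), (∀ t, ∃ i, ∀ z ∈ S, g i (Sum.inl t) ≤ g i z) →
        ∀ x ∈ S, ∃ i, ∀ z ∈ S, g i x ≤ g i z := by
      rintro S hS (t | k) _
      · exact hS t
      · exact ⟨k, fun z _ => h4 k z⟩
    have hsurj : ∀ d ∈ D, ∃ i, m i = d := by
      intro d hd
      obtain ⟨i, hi⟩ := hminof D hDom d hd
      exact ⟨i, (hmu i d (le_antisymm (hi _ (hmD i)) (hm i d hd))).symm⟩
    obtain ⟨a, -, b, -, hab, hmab⟩ := exists_ne_map_eq_of_card_lt_of_maps_to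
      (s := (univ : Finset I)) (t := D) (f := m) (by rw [card_univ]; omega) (fun i _ => hmD i)
    have key : ∀ a b, a ≠ b → m a = m b → ∃ x, x ∉ D ∧
        (∀ t, ∃ i, ∀ z ∈ insert x D, g i (Sum.inl t) ≤ g i z) ∧
        g a x ≤ g a (m a) ∧ (∀ j, j ≠ a → g j (m j) < g j x) ∧
        ∀ z, (∀ t, ∃ i, ∀ y ∈ insert z D, g i (Sum.inl t) ≤ g i y) →
          (∀ j, j ≠ a → g j (m j) < g j z) → z = x := by
      intro a b hab hmab
      obtain ⟨x, hx, hxmax⟩ := exists_max_image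
        (univ.filter (fun x => ∀ j, j ≠ a → g j (m j) < g j x)) (fun x => g a x)
        ⟨Sum.inr a, by
          simp only [mem_filter, mem_univ, true_and]
          intro j hj
          rcases hmj : m j with t | k
          · exact h2 _ _ _ hj.symm
          · obtain rfl := hmk j k hmj
            exact h3 _ _ hj.symm⟩
      simp only [mem_filter, mem_univ, true_and] at hx hxmax
      have hU : ∀ y : T ⊕ I, (∀ j, j ≠ a → g j (m j) < g j y) → ∀ k, y = Sum.inr k → k = a := by
        rintro y hy k rfl
        by_contra hk
        exact absurd (hy k hk) (not_lt.2 (h4 _ _))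
      have hxm : g a x ≤ g a (m a) := by
        rcases x with t | k
        · obtain ⟨i, hi⟩ := hDom t
          by_cases hia : i = a
          · subst hia; exact hi _ (hmD _)
          · exact absurd (hi _ (hmD i)) (not_le.2 (hx i hia))
        · obtain rfl := hU _ hx k rfl
          exact h4 _ _
      refine ⟨x, ?_, ?_, hxm, hx, ?_⟩
      · intro hxD
        obtain ⟨i, hi⟩ := hsurj x hxD
        by_cases hia : i = a
        · subst hia
          have := hx b hab.symm
          rw [← hmab, hi] at this
          exact lt_irrefl _ this
        · have := hx i hia
          rw [hi] at this
          exact lt_irrefl _ this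
      · intro t
        by_cases ht : ∀ j, j ≠ a → g j (m j) < g j (Sum.inl t)
        · refine ⟨a, fun z hz => ?_⟩
          rcases mem_insert.1 hz with rfl | hz
          · exact hxmax _ ht
          · exact (hxmax _ ht).trans (hxm.trans (hm a z hz))
        · push Not at ht
          obtain ⟨j, hj, hjt⟩ := ht
          refine ⟨j, fun z hz => ?_⟩
          rcases mem_insert.1 hz with rfl | hz
          · exact hjt.trans (hx j hj).le
          · exact hjt.trans (hm j z hz)
      · intro z hz hzU
        apply (inj' a x z (hU z hzU) ?_).symm
        apply le_antisymm _ (hxmax z hzU)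
        rcases x with t | k
        · obtain ⟨i, hi⟩ := hz t
          by_cases hia : i = a
          · subst hia; exact hi z (mem_insert_self _ _)
          · exact absurd (hi _ (mem_insert_of_mem (hmD i))) (not_le.2 (hx i hia))
        · obtain rfl := hU _ hx k rfl
          exact h4 _ _
    have hclass : ∀ z, z ∉ D → (∀ t, ∃ i, ∀ y ∈ insert z D, g i (Sum.inl t) ≤ g i y) →
        (∀ j, j ≠ a → g j (m j) < g j z) ∨ (∀ j, j ≠ b → g j (m j) < g j z) := by
      intro z hzD hz
      obtain ⟨i, hi⟩ := hminof _ hz z (mem_insert_self _ _)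
      have hPi : ¬ g i (m i) < g i z := not_lt.2 (hi _ (mem_insert_of_mem (hmD i)))
      have hPs : (univ.filter (fun j => g j (m j) < g j z)).image m = D := by
        ext d
        simp only [mem_image, mem_filter, mem_univ, true_and]
        constructor
        · rintro ⟨j, -, rfl⟩; exact hmD j
        · intro hd
          obtain ⟨j, hj⟩ := hminof _ hz d (mem_insert_of_mem hd)
          have hdj : d = m j :=
            hmu j d (le_antisymm (hj _ (mem_insert_of_mem (hmD j))) (hm j d hd))
          refine ⟨j, ?_, hdj.symm⟩
          have hle := hj z (mem_insert_self _ _)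
          rw [hdj] at hle
          refine lt_of_le_of_ne hle fun he => hzD ?_
          rw [hmu j z he.symm]; exact hmD j
      have hsubs : univ.filter (fun j => g j (m j) < g j z) ⊆ univ.erase i := by
        intro j hj
        simp only [mem_filter, mem_univ, true_and] at hj
        simp only [mem_erase, mem_univ, and_true]
        rintro rfl
        exact hPi hj
      have hc1 : (univ.erase i).card = D.card := by
        rw [card_erase_of_mem (mem_univ _), card_univ]; omega
      have hPe : univ.filter (fun j => g j (m j) < g j z) = univ.erase i := by
        apply eq_of_subset_of_card_le hsubs
        rw [hc1, ← hPs]; exact card_image_le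
      rw [hPe] at hPs
      have hI : Set.InjOn m (univ.erase i : Finset I) := by
        apply card_image_iff.1
        rw [hPs, hc1]
      have hall : ∀ j, j ≠ i → g j (m j) < g j z := by
        intro j hj
        have : j ∈ univ.filter (fun j => g j (m j) < g j z) := by rw [hPe]; simp [hj]
        simpa using this
      by_cases hai : i = a
      · subst hai; exact Or.inl hall
      by_cases hbi : i = b
      · subst hbi; exact Or.inr hall
      exact absurd (hI (by simp [Ne.symm hai]) (by simp [Ne.symm hbi]) hmab) hab
    obtain ⟨x, hxD, hxDom, hxa, hxU, hxu⟩ := key a b hab hmab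
    obtain ⟨y, hyD, hyDom, hyb, hyU, hyu⟩ := key b a hab.symm hmab.symm
    have hxy : x ≠ y := by
      rintro rfl
      exact absurd (hyU a hab) (not_lt.2 hxa)
    have : (univ.filter (fun x => x ∉ D ∧ (insert x D = univ.image Sum.inr ∨
      ∀ t, ∃ i, ∀ z ∈ insert x D, g i (Sum.inl t) ≤ g i z))) = {x, y} := by
      ext z
      simp only [mem_filter, mem_univ, true_and, mem_insert (b := x), mem_singleton]
      constructor
      · rintro ⟨hzD, hz⟩
        have hz := hz.resolve_left (hns z hzD)
        rcases hclass z hzD hz with h | h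
        · exact Or.inl (hxu z hz h)
        · exact Or.inr (hyu z hz h)
      · rintro (rfl | rfl)
        · exact ⟨hxD, Or.inr hxDom⟩
        · exact ⟨hyD, Or.inr hyDom⟩
    rw [this, card_pair hxy]
    decide

open Finset in
theorem nbg_scarf {T I : Type*} [Fintype T] [DecidableEq T] [Nonempty T] [Fintype I] [DecidableEq I]
    [Nonempty I] (f : I → T → ℕ) (hf : ∀ i, Function.Injective (f i)) (c : T → I) :
    ∃ (A : Finset T) (J : Finset I), J.Nonempty ∧ (∀ i ∈ J, ∃ t ∈ A, c t = i) ∧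
      ∀ y, ∃ i ∈ J, ∀ t ∈ A, f i y ≤ f i t := by
  classical
  obtain ⟨M, hM⟩ : ∃ M : ℕ, ∀ i t, f i t < M := by
    refine ⟨(∑ i, ∑ t, f i t) + 1, fun i t => Nat.lt_succ_of_le ?_⟩
    calc f i t ≤ ∑ t, f i t := single_le_sum (f := fun t => f i t) (fun _ _ => Nat.zero_le _) (mem_univ t)
      _ ≤ _ := single_le_sum (f := fun i => ∑ t, f i t) (fun _ _ => Nat.zero_le _) (mem_univ i)
  let g : I → T ⊕ I → ℤ := fun i => Sum.elim (fun t => (f i t : ℤ)) (fun k => if k = i then -1 else M)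
  have h1 : ∀ i t, g i (Sum.inr i) < g i (Sum.inl t) := by
    intro i t; simp only [g, Sum.elim_inl, Sum.elim_inr, if_true]; omega
  have h2 : ∀ i k t, k ≠ i → g i (Sum.inl t) < g i (Sum.inr k) := by
    intro i k t hk; simp only [g, Sum.elim_inl, Sum.elim_inr, if_neg hk]; exact_mod_cast hM i t
  have h3 : ∀ i t t', g i (Sum.inl t) = g i (Sum.inl t') → t = t' := by
    intro i t t' h; simp only [g, Sum.elim_inl] at h; exact hf i (by exact_mod_cast h)
  let R : Finset (Finset (T ⊕ I)) := univ.filter (fun S => S.card = Fintype.card I ∧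
    (S = univ.image Sum.inr ∨ ∀ t, ∃ i, ∀ z ∈ S, g i (Sum.inl t) ≤ g i z))
  have hev := nbg_pseudo (Sum.elim c id) (Classical.arbitrary I) R
    (fun S hS => (mem_filter.1 hS).2.1) (by
      intro D hD
      convert nbg_door g h1 h2 h3 D hD using 2
      ext x
      simp only [R, mem_filter, mem_univ, true_and]
      constructor
      · rintro ⟨h, h'⟩; exact ⟨h, h'.2⟩
      · rintro ⟨h, h'⟩; exact ⟨h, by rw [card_insert_of_notMem h, hD], h'⟩)
  have hI : univ.image Sum.inr ∈ R.filter (fun S => S.image (Sum.elim c id) = univ) := by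
    simp only [R, mem_filter, mem_univ, true_and]
    refine ⟨⟨by rw [card_image_of_injective _ Sum.inr_injective, card_univ], Or.inl trivial⟩, ?_⟩
    ext i; simp
  obtain ⟨S, hS, hSne⟩ : ∃ S ∈ R.filter (fun S : Finset (T ⊕ I) => S.image (Sum.elim c id) = univ),
      S ≠ univ.image Sum.inr := by
    apply exists_mem_ne
    have := card_pos.2 ⟨_, hI⟩
    rcases hev with ⟨k, hk⟩
    omega
  simp only [R, mem_filter, mem_univ, true_and] at hS
  obtain ⟨⟨-, hS⟩, hcol⟩ := hS
  have hdom := hS.resolve_left hSne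
  have hdom' : ∀ y, ∃ i, Sum.inr i ∉ S ∧ ∀ z ∈ S, g i (Sum.inl y) ≤ g i z := by
    intro y
    obtain ⟨i, hi⟩ := hdom y
    exact ⟨i, fun h => absurd (hi _ h) (not_le.2 (h1 _ _)), hi⟩
  refine ⟨univ.filter (fun t => Sum.inl t ∈ S), univ.filter (fun i => Sum.inr i ∉ S), ?_, ?_, ?_⟩
  · obtain ⟨i, hi, -⟩ := hdom' (Classical.arbitrary T)
    exact ⟨i, by simpa using hi⟩
  · intro i hi
    simp only [mem_filter, mem_univ, true_and] at hi
    obtain ⟨z, hz, hzi⟩ := mem_image.1 (hcol ▸ mem_univ i)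
    rcases z with t | k
    · exact ⟨t, by simpa using hz, hzi⟩
    · simp only [Sum.elim_inr, id] at hzi
      exact absurd (hzi ▸ hz) hi
  · intro y
    obtain ⟨i, hi, hi2⟩ := hdom' y
    refine ⟨i, by simpa using hi, fun t ht => ?_⟩
    have := hi2 (Sum.inl t) (by simpa using ht)
    simp only [g, Sum.elim_inl] at this
    exact_mod_cast this
open Finset in
theorem nbg_grid (n : ℕ) (hn : 1 ≤ n) (N : ℕ) (c : (Fin n → ℕ) → Fin n) :
    ∃ t0 : Fin n → ℕ, ∑ j, t0 j = N ∧ ∀ i, t0 i < n ∨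
      ∃ t : Fin n → ℕ, ∑ j, t j = N ∧ c t = i ∧ ∀ j, t j < t0 j + n ∧ t0 j < t j + n := by
  classical
  haveI : Nonempty (Fin n) := ⟨⟨0, hn⟩⟩
  let P : Finset (Fin n → ℕ) := piAntidiag univ N
  have hP : ∀ y, y ∈ P ↔ ∑ j, y j = N := by
    intro y; simp [P, mem_piAntidiag]
  haveI : Nonempty P := ⟨⟨Pi.single ⟨0, hn⟩ N, by rw [hP]; simp⟩⟩
  let e := Fintype.equivFin P
  let K := Fintype.card P
  have hfle : ∀ i (y t : P), y.1 i * K + (e y : ℕ) ≤ t.1 i * K + (e t : ℕ) → y.1 i ≤ t.1 i := by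
    intro i y t h
    by_contra! hlt
    have h1 : (t.1 i + 1) * K ≤ y.1 i * K := Nat.mul_le_mul_right _ hlt
    have h2 : (e t : ℕ) < K := (e t).2
    rw [add_mul, one_mul] at h1
    omega
  obtain ⟨A, J, hJ, hcol, hdom⟩ := nbg_scarf (T := P) (I := Fin n)
    (fun i y => y.1 i * K + (e y : ℕ)) (by
      intro i y t h
      have h' : y.1 i * K + (e y : ℕ) = t.1 i * K + (e t : ℕ) := h
      have h1 := le_antisymm (hfle i y t h'.le) (hfle i t y h'.ge)
      rw [h1] at h'
      exact e.injective (Fin.ext (by omega))) (fun y => c y.1)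
  obtain ⟨j0, hj0⟩ := hJ
  obtain ⟨t0, ht0, -⟩ := hcol j0 hj0
  have hmin : ∀ i, ∃ m : ℕ, (∀ t ∈ A, m ≤ t.1 i) ∧ (i ∈ J → ∃ t ∈ A, t.1 i = m) ∧ (i ∉ J → m = 0) := by
    intro i
    by_cases hi : i ∈ J
    · obtain ⟨t, ht, hm⟩ := exists_min_image A (fun t => t.1 i) ⟨t0, ht0⟩
      exact ⟨t.1 i, hm, fun _ => ⟨t, ht, rfl⟩, fun h => absurd hi h⟩
    · exact ⟨0, by simp, fun h => absurd h hi, fun _ => rfl⟩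
  choose m hmA hmJ hm0 using hmin
  have hsum : N < ∑ i, m i + n := by
    by_contra! hle
    have hle2 : ∑ i, (m i + 1) ≤ N := by
      rw [sum_add_distrib]; simpa using hle
    let y : Fin n → ℕ := fun i => (m i + 1) + (Pi.single j0 (N - ∑ i, (m i + 1)) : Fin n → ℕ) i
    have hy : ∑ i, y i = N := by
      simp only [y]
      rw [sum_add_distrib, sum_pi_single']
      simp only [mem_univ, if_true]
      omega
    obtain ⟨i, hi, hid⟩ := hdom ⟨y, (hP y).2 hy⟩
    obtain ⟨t, ht, htm⟩ := hmJ i hi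
    have h := hfle i _ t (hid t ht)
    simp only [y, htm] at h
    omega
  have hclose : ∀ t ∈ A, ∀ i, t.1 i < m i + n := by
    intro t ht i
    have h1 : ∑ j, t.1 j = N := (hP _).1 t.2
    have h2 : ∑ j ∈ univ.erase i, m j ≤ ∑ j ∈ univ.erase i, t.1 j := sum_le_sum fun j _ => hmA j t ht
    have h3 := add_sum_erase univ t.1 (mem_univ i)
    have h4 := add_sum_erase univ m (mem_univ i)
    omega
  refine ⟨t0.1, (hP _).1 t0.2, fun i => ?_⟩
  by_cases hi : i ∈ J
  · right
    obtain ⟨t, ht, hct⟩ := hcol i hi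
    refine ⟨t.1, (hP _).1 t.2, hct, fun j => ?_⟩
    have := hclose t ht j
    have := hclose t0 ht0 j
    have := hmA j t ht
    have := hmA j t0 ht0
    omega
  · left
    have := hclose t0 ht0 i
    rw [hm0 i hi] at this
    omega

open Filter Topology in
/-- Every NBG with continuous nonnegative cost functions admits an equilibrium. -/
theorem stmt_1 (n : ℕ) (hn : 1 ≤ n) (r : ℝ) (hr : 0 < r)
    (C : Fin n → (Fin n → ℝ) → ℝ)
    (hnn : ∀ i x, x ∈ {y : Fin n → ℝ | (∀ j, 0 ≤ y j) ∧ ∑ j, y j = r} → 0 ≤ C i x)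
    (hcont : ∀ i, ContinuousOn (C i) {y : Fin n → ℝ | (∀ j, 0 ≤ y j) ∧ ∑ j, y j = r}) :
    ∃ x : Fin n → ℝ, (∀ j, 0 ≤ x j) ∧ ∑ j, x j = r ∧
      ∀ i j, 0 < x i → C i x ≤ C j x := by
  haveI : Nonempty (Fin n) := ⟨⟨0, hn⟩⟩
  set Δ : Set (Fin n → ℝ) := {y : Fin n → ℝ | (∀ j, 0 ≤ y j) ∧ ∑ j, y j = r} with hΔ
  have hcompact : IsCompact Δ := by
    apply (isCompact_univ_pi (fun _ : Fin n => isCompact_Icc (a := (0 : ℝ)) (b := r))).of_isClosed_subset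
    · apply IsClosed.inter
      · have : {y : Fin n → ℝ | ∀ j, 0 ≤ y j} = ⋂ j, {y | 0 ≤ y j} := by ext; simp
        change IsClosed {y : Fin n → ℝ | ∀ j, 0 ≤ y j}
        rw [this]
        exact isClosed_iInter fun j => isClosed_le continuous_const (continuous_apply j)
      · exact isClosed_eq (by fun_prop) continuous_const
    · rintro y ⟨h1, h2⟩ j -
      refine ⟨h1 j, ?_⟩
      rw [← h2]
      exact Finset.single_le_sum (f := y) (fun i _ => h1 i) (Finset.mem_univ j)
  have happrox : ∀ N : ℕ, ∃ x ∈ Δ, ∀ i, ∃ z ∈ Δ, dist z x ≤ r * n / (N + 1) ∧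
      (x i ≤ r * n / (N + 1) ∨ ∀ j, C i z ≤ C j z) := by
    intro N
    have hN : (0 : ℝ) < (N : ℝ) + 1 := by positivity
    let s : (Fin n → ℕ) → (Fin n → ℝ) := fun t j => r * (t j : ℝ) / (N + 1)
    have hs : ∀ t : Fin n → ℕ, ∑ j, t j = N + 1 → s t ∈ Δ := by
      intro t ht
      refine ⟨fun j => by simp only [s]; positivity, ?_⟩
      simp only [s]
      rw [← Finset.sum_div, ← Finset.mul_sum, ← Nat.cast_sum, ht]
      push_cast
      field_simp
    have hc : ∀ t : Fin n → ℕ, ∃ i, ∀ j, C i (s t) ≤ C j (s t) := fun t =>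
      Finite.exists_min fun i => C i (s t)
    choose c hc using hc
    obtain ⟨t0, ht0, h⟩ := nbg_grid n hn (N + 1) c
    refine ⟨s t0, hs t0 ht0, fun i => ?_⟩
    rcases h i with h | ⟨t, ht, hti, hd⟩
    · refine ⟨s t0, hs t0 ht0, by rw [dist_self]; positivity, Or.inl ?_⟩
      simp only [s]
      have : (t0 i : ℝ) ≤ n := by exact_mod_cast h.le
      gcongr
    · refine ⟨s t, hs t ht, ?_, Or.inr (hti ▸ hc t)⟩
      rw [dist_pi_le_iff (by positivity)]
      intro j
      have h1 : (t j : ℝ) ≤ t0 j + n := by exact_mod_cast (hd j).1.le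
      have h2 : (t0 j : ℝ) ≤ t j + n := by exact_mod_cast (hd j).2.le
      have h3 : |(t j : ℝ) - t0 j| ≤ n := abs_le.2 ⟨by linarith, by linarith⟩
      rw [Real.dist_eq]
      have h4 : s t j - s t0 j = r / (N + 1) * ((t j : ℝ) - t0 j) := by simp only [s]; ring
      rw [h4, abs_mul, abs_of_pos (by positivity)]
      calc r / (N + 1) * |(t j : ℝ) - t0 j| ≤ r / (N + 1) * n := by gcongr
        _ = _ := by ring
  choose x hxΔ z hzΔ hzd hz using happrox
  obtain ⟨xs, hxs, φ, hφ, hlim⟩ := hcompact.tendsto_subseq hxΔ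
  have hε : Tendsto (fun N : ℕ => r * n / ((N : ℝ) + 1)) atTop (𝓝 0) := by
    have := (tendsto_one_div_add_atTop_nhds_zero_nat (𝕜 := ℝ)).const_mul (r * n)
    simpa [div_eq_mul_inv] using this
  have hε' := hε.comp hφ.tendsto_atTop
  refine ⟨xs, hxs.1, hxs.2, fun i j hi => ?_⟩
  have hzlim : Tendsto (fun k => z (φ k) i) atTop (𝓝 xs) := by
    apply hlim.congr_dist
    refine squeeze_zero (fun _ => dist_nonneg) (fun k => ?_) hε'
    rw [dist_comm]; exact hzd (φ k) i
  have hzw : Tendsto (fun k => z (φ k) i) atTop (𝓝[Δ] xs) :=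
    tendsto_nhdsWithin_iff.2 ⟨hzlim, Eventually.of_forall fun k => hzΔ _ _⟩
  have hCi := (hcont i xs hxs).tendsto.comp hzw
  have hCj := (hcont j xs hxs).tendsto.comp hzw
  have hxi : Tendsto (fun k => x (φ k) i) atTop (𝓝 (xs i)) := (tendsto_pi_nhds.1 hlim) i
  refine le_of_tendsto_of_tendsto hCi hCj ?_
  filter_upwards [hε'.eventually_lt hxi hi] with k hk
  exact ((hz (φ k) i).resolve_left (not_le.2 hk)) j
end

section
/- In the normal linear NBG on 3 vertices with arcs (1,2),(2,3),(3,1), each with coefficient α > 0, and total mass 1, the distribution (1/3,1/3,1/3) is an equilibrium, but it is not a δ-strong equilibrium for any δ > 0 when α > 2. -/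
/-- Cost in the normal linear NBG on the 3-cycle with arcs (1,2),(2,3),(3,1), each with
coefficient `α`: the in-neighbour of `i` is `i - 1`. -/
def cycCost (α : ℝ) (x : Fin 3 → ℝ) (i : Fin 3) : ℝ := x i + α * x (i - 1)

/-- The distribution obtained from `x` by moving mass `ε` from vertex `i` to vertex `j`. -/
def moveMass3 (x : Fin 3 → ℝ) (i j : Fin 3) (ε : ℝ) : Fin 3 → ℝ :=
  fun k => x k - (if k = i then ε else 0) + (if k = j then ε else 0)

/-- On the directed 3-cycle with coefficient α > 0 and total mass 1,
the distribution (1/3,1/3,1/3) is an equilibrium, but for α > 2 it is not a δ-strong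
equilibrium for any δ > 0. -/
theorem stmt_6 (α : ℝ) (hα : 0 < α) :
    (∀ i j : Fin 3, 0 < (fun _ : Fin 3 => (1 : ℝ) / 3) i →
        cycCost α (fun _ => (1 : ℝ) / 3) i ≤ cycCost α (fun _ => (1 : ℝ) / 3) j) ∧
    (2 < α → ∀ δ : ℝ, 0 < δ →
      ¬ (∀ ε : ℝ, 0 ≤ ε → ε ≤ δ → ∀ i j : Fin 3,
          ε ≤ (fun _ : Fin 3 => (1 : ℝ) / 3) i →
          cycCost α (fun _ => (1 : ℝ) / 3) i ≤
            cycCost α (moveMass3 (fun _ => (1 : ℝ) / 3) i j ε) j)) := by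
  refine ⟨fun i j _ => le_refl _, ?_⟩
  intro h2 δ hδ H
  have hε : 0 < min δ (1 / 3) := lt_min hδ (by norm_num)
  have h := H (min δ (1 / 3)) hε.le (min_le_left _ _) 0 1 (min_le_right _ _)
  generalize min δ (1 / 3) = ε at h hε
  simp [cycCost, moveMass3] at h
  nlinarith [mul_pos hε (sub_pos.mpr h2)]
end
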